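/- arXiv:2402.08525 — 3 statements merged into one kernel-verified Lean document; each statement's English description precedes it below -/
import Mathlib

section
/- For every continuous bounded function f on [0,b), one has ∫_{[0,1)} f(bx) dμ(x) = f(0) + (1/b) Σ_{a∈A} ∫_{[0,1)} f(a+x) dμ(x). -/
open MeasureTheory

def Admissible (b : ℕ) (A : Finset ℕ) (n : ℕ) : Prop :=
  (∀ d ∈ Nat.digits b n, d ∈ A) ∧ (n = 0 → 0 ∈ A)

instance (b : ℕ) (A : Finset ℕ) (n : ℕ) : Decidable (Admissible b A n) := by
  unfold Admissible
  infer_instance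

noncomputable def kempnerMeasure (b : ℕ) (A : Finset ℕ) : Measure ℝ :=
  if 0 ∈ A then
    Measure.sum fun l : ℕ =>
      ((b : ENNReal) ^ l)⁻¹ •
        Measure.sum fun n : {n : ℕ // Admissible b A n} =>
          Measure.dirac (((n : ℕ) : ℝ) / (b : ℝ) ^ l)
  else
    Measure.dirac 0 +
      Measure.sum fun l : ℕ =>
        ((b : ENNReal) ^ l)⁻¹ •
          Measure.sum
            (fun n : {n : ℕ // Admissible b A n ∧ l ≤ (Nat.digits b n).length} =>
              Measure.dirac (((n : ℕ) : ℝ) / (b : ℝ) ^ l))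

noncomputable def moment (b : ℕ) (A : Finset ℕ) (m : ℕ) : ℝ :=
  ∫ x in Set.Ico (0 : ℝ) 1, x ^ m ∂(kempnerMeasure b A)

noncomputable def kempnerSum (b : ℕ) (A : Finset ℕ) : ℝ :=
  ∑' n : {n : ℕ // 0 < n ∧ Admissible b A n}, (1 : ℝ) / ((n : ℕ) : ℝ)

def KP (b : ℕ) (A : Finset ℕ) (l n : ℕ) : Prop := ∀ i < l, n / b ^ i % b ∈ A

open Classical in
noncomputable def KS (b : ℕ) (A : Finset ℕ) (l : ℕ) : Finset ℕ :=
  (Finset.range (b ^ l)).filter (KP b A l)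

theorem KS_mem (b : ℕ) (A : Finset ℕ) (l n : ℕ) :
    n ∈ KS b A l ↔ n < b ^ l ∧ ∀ i < l, n / b ^ i % b ∈ A := by
  simp [KS, KP]

theorem KP_step (b : ℕ) (hb : 1 < b) (A : Finset ℕ) (hA : ∀ a ∈ A, a < b) (l a m : ℕ)
    (ha : a < b) (hm : m < b ^ l) :
    a * b ^ l + m ∈ KS b A (l + 1) ↔ a ∈ A ∧ m ∈ KS b A l := by
  have hpos : 0 < b ^ l := by positivity
  have h1 : ∀ i < l, (a * b ^ l + m) / b ^ i % b = m / b ^ i % b := by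
    intro i hi
    obtain ⟨k, rfl⟩ : ∃ k, l = i + (k + 1) := ⟨l - i - 1, by omega⟩
    have : a * b ^ (i + (k + 1)) + m = m + b ^ i * (b * (a * b ^ k)) := by ring
    rw [this, Nat.add_mul_div_left _ _ (by positivity), Nat.add_mul_mod_self_left]
  have h2 : (a * b ^ l + m) / b ^ l % b = a := by
    rw [mul_comm, Nat.mul_add_div hpos, Nat.div_eq_of_lt hm, add_zero, Nat.mod_eq_of_lt ha]
  have h3 : a * b ^ l + m < b ^ (l + 1) := by
    have : (a + 1) * b ^ l ≤ b * b ^ l := Nat.mul_le_mul_right _ ha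
    rw [pow_succ]; nlinarith
  rw [KS_mem, KS_mem]
  constructor
  · rintro ⟨-, h⟩
    refine ⟨h2 ▸ h l (by omega), hm, fun i hi => h1 i hi ▸ h i (by omega)⟩
  · rintro ⟨h, -, h'⟩
    refine ⟨h3, fun i hi => ?_⟩
    rcases Nat.lt_succ_iff_lt_or_eq.mp hi with hi | rfl
    · rw [h1 i hi]; exact h' i hi
    · rw [h2]; exact h

theorem KS_sum (b : ℕ) (hb : 1 < b) (A : Finset ℕ) (hA : ∀ a ∈ A, a < b) (l : ℕ)
    (g : ℕ → ENNReal) :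
    ∑ n ∈ KS b A (l + 1), g n = ∑ a ∈ A, ∑ m ∈ KS b A l, g (a * b ^ l + m) := by
  have hpos : 0 < b ^ l := by positivity
  rw [← Finset.sum_product']
  symm
  refine Finset.sum_bij' (fun p _ => p.1 * b ^ l + p.2) (fun n _ => (n / b ^ l, n % b ^ l))
    ?_ ?_ ?_ ?_ ?_
  · rintro ⟨a, m⟩ h
    rw [Finset.mem_product] at h
    exact (KP_step b hb A hA l a m (hA _ h.1) ((KS_mem _ _ _ _).1 h.2).1).2 h
  · intro n hn
    rw [Finset.mem_product]
    have hlt := ((KS_mem _ _ _ _).1 hn).1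
    refine (KP_step b hb A hA l _ _ ?_ (Nat.mod_lt _ hpos)).1 ?_
    · rw [Nat.div_lt_iff_lt_mul hpos]; rwa [pow_succ, mul_comm] at hlt
    · rw [Nat.div_add_mod']; exact hn
  · rintro ⟨a, m⟩ h
    rw [Finset.mem_product] at h
    have hm := ((KS_mem _ _ _ _).1 h.2).1
    simp only [Prod.mk.injEq]
    constructor
    · rw [mul_comm, Nat.mul_add_div hpos, Nat.div_eq_of_lt hm, add_zero]
    · rw [mul_comm, Nat.mul_add_mod, Nat.mod_eq_of_lt hm]
  · intro n hn
    exact Nat.div_add_mod' _ _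
  · intro _ _; rfl

theorem KS_card (b : ℕ) (hb : 1 < b) (A : Finset ℕ) (hA : ∀ a ∈ A, a < b) (l : ℕ) :
    ((KS b A l).card : ENNReal) = (A.card : ENNReal) ^ l := by
  induction l with
  | zero =>
    have : KS b A 0 = {0} := by ext n; rw [KS_mem]; simp
    simp [this]
  | succ l ih =>
    have := KS_sum b hb A hA l (fun _ => 1)
    simp only [Finset.sum_const, nsmul_eq_mul, mul_one] at this
    rw [this, ih, pow_succ, mul_comm]

theorem digits_all (b : ℕ) (hb : 1 < b) (A : Finset ℕ) (n : ℕ) :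
    (∀ d ∈ Nat.digits b n, d ∈ A) ↔ ∀ i < (Nat.digits b n).length, n / b ^ i % b ∈ A := by
  rw [List.forall_mem_iff_forall_getElem]
  refine forall₂_congr fun i hi => ?_
  rw [← Nat.getD_digits n i hb, List.getD_eq_getElem _ _ hi]

theorem adm_zero (b : ℕ) (hb : 1 < b) (A : Finset ℕ) (h0 : 0 ∈ A) (l n : ℕ) :
    n ∈ KS b A l ↔ n < b ^ l ∧ Admissible b A n := by
  rw [KS_mem, Admissible, digits_all b hb]
  refine and_congr_right fun hn => ?_
  have hl := (Nat.digits_length_le_iff hb n (k := l)).2 hn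
  simp only [h0, implies_true, and_true]
  constructor
  · intro h i hi; exact h i (by omega)
  · intro h i hi
    by_cases hi' : i < (Nat.digits b n).length
    · exact h i hi'
    · rw [← Nat.getD_digits n i hb, List.getD_eq_default _ _ (by omega)]; exact h0

theorem adm_nz (b : ℕ) (hb : 1 < b) (A : Finset ℕ) (h0 : 0 ∉ A) (l n : ℕ) :
    n ∈ KS b A l ↔ (l = 0 ∧ n = 0) ∨
      (n < b ^ l ∧ (Admissible b A n ∧ l ≤ (Nat.digits b n).length)) := by
  rw [KS_mem, Admissible, digits_all b hb]
  have hl := Nat.digits_length_le_iff hb n (k := l)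
  constructor
  · rintro ⟨hn, h⟩
    have hl := hl.2 hn
    rcases Nat.eq_zero_or_pos l with rfl | hlp
    · left; simpa using hn
    · right
      have hle : l ≤ (Nat.digits b n).length := by
        by_contra hc
        have := h (l - 1) (by omega)
        rw [← Nat.getD_digits n _ hb, List.getD_eq_default _ _ (by omega)] at this
        exact h0 this
      refine ⟨hn, ⟨fun i hi => h i (by omega), ?_⟩, hle⟩
      rintro rfl
      simp at hle; omega
  · rintro (⟨rfl, rfl⟩ | ⟨hn, ⟨h, -⟩, hle⟩)
    · simp
    · exact ⟨hn, fun i hi => h i (by omega)⟩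

theorem mem_Ico_iff (b : ℕ) (hb : 1 < b) (l n : ℕ) :
    ((n : ℝ) / (b : ℝ) ^ l ∈ Set.Ico (0 : ℝ) 1) ↔ n < b ^ l := by
  have : (0 : ℝ) < (b : ℝ) ^ l := by positivity
  rw [Set.mem_Ico, div_lt_one this]
  constructor
  · rintro ⟨-, h⟩; exact_mod_cast h
  · intro h; exact ⟨by positivity, by exact_mod_cast h⟩

theorem sum_dirac_aux (b : ℕ) (hb : 1 < b) (l : ℕ) (p : ℕ → Prop) (S : Finset ℕ)
    (hS : ∀ n, n ∈ S ↔ n < b ^ l ∧ p n) (E : Set ℝ) (hE : MeasurableSet E) :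
    (Measure.sum fun n : {n : ℕ // p n} => Measure.dirac (((n : ℕ) : ℝ) / (b : ℝ) ^ l))
      (E ∩ Set.Ico 0 1) = ∑ n ∈ S, E.indicator (1 : ℝ → ENNReal) ((n : ℝ) / (b : ℝ) ^ l) := by
  rw [Measure.sum_apply _ (hE.inter measurableSet_Ico)]
  simp only [Measure.dirac_apply' _ (hE.inter measurableSet_Ico)]
  have h1 := tsum_subtype {n : ℕ | p n}
    (fun n : ℕ => (E ∩ Set.Ico 0 1).indicator (1 : ℝ → ENNReal) ((n : ℝ) / (b : ℝ) ^ l))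
  refine h1.trans ?_
  rw [tsum_eq_sum (s := S)]
  · refine Finset.sum_congr rfl fun n hn => ?_
    have h := (hS n).1 hn
    rw [Set.indicator_of_mem (show n ∈ {n : ℕ | p n} from h.2)]
    have h2 := (mem_Ico_iff b hb l n).2 h.1
    by_cases hx : (n : ℝ) / (b : ℝ) ^ l ∈ E
    · rw [Set.indicator_of_mem hx]
      exact Set.indicator_of_mem (show _ ∈ E ∩ Set.Ico 0 1 from ⟨hx, h2⟩) _
    · rw [Set.indicator_of_notMem (fun h => hx h.1), Set.indicator_of_notMem hx]
  · intro n hn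
    rw [hS, not_and_or] at hn
    by_cases hp : p n
    · rw [Set.indicator_of_mem (show n ∈ {n : ℕ | p n} from hp), Set.indicator_of_notMem]
      intro h
      exact hn.elim (fun h' => h' ((mem_Ico_iff b hb l n).1 h.2)) (fun h' => h' hp)
    · exact Set.indicator_of_notMem hp _

theorem KS_zero (b : ℕ) (A : Finset ℕ) : KS b A 0 = {0} := by
  ext n; rw [KS_mem]; simp

theorem kempner_apply (b : ℕ) (hb : 1 < b) (A : Finset ℕ) (E : Set ℝ) (hE : MeasurableSet E) :
    ((kempnerMeasure b A).restrict (Set.Ico 0 1)) E =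
      ∑' l : ℕ, ((b : ENNReal) ^ l)⁻¹ *
        ∑ n ∈ KS b A l, E.indicator (1 : ℝ → ENNReal) ((n : ℝ) / (b : ℝ) ^ l) := by
  rw [Measure.restrict_apply hE, kempnerMeasure]
  have hEI := hE.inter (measurableSet_Ico (a := (0 : ℝ)) (b := 1))
  split_ifs with h0
  · rw [Measure.sum_apply _ hEI]
    refine tsum_congr fun l => ?_
    rw [Measure.smul_apply, smul_eq_mul,
      sum_dirac_aux b hb l _ _ (adm_zero b hb A h0 l) E hE]
  · rw [Measure.add_apply, Measure.sum_apply _ hEI,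
      tsum_eq_zero_add' (f := fun l : ℕ => ((b : ENNReal) ^ l)⁻¹ *
        ∑ n ∈ KS b A l, E.indicator (1 : ℝ → ENNReal) ((n : ℝ) / (b : ℝ) ^ l))
        ENNReal.summable, tsum_eq_zero_add' ENNReal.summable, ← add_assoc]
    congr 1
    · rw [Measure.smul_apply, smul_eq_mul, sum_dirac_aux b hb 0 _ ∅ _ E hE, KS_zero,
        Measure.dirac_apply' _ hEI]
      · rw [Finset.sum_singleton]
        by_cases hx : (0 : ℝ) ∈ E <;> simp [Set.indicator, hx]
      · intro n
        simp only [Finset.notMem_empty, false_iff, pow_zero, Nat.lt_one_iff]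
        rintro ⟨rfl, h, -⟩
        exact h0 (h.2 rfl)
    · refine tsum_congr fun l => ?_
      rw [Measure.smul_apply, smul_eq_mul, sum_dirac_aux b hb (l + 1) _ _ _ E hE]
      intro n
      rw [adm_nz b hb A h0]
      simp

theorem kempner_fixed (b : ℕ) (hb : 1 < b) (A : Finset ℕ) (hA : ∀ a ∈ A, a < b) :
    (kempnerMeasure b A).restrict (Set.Ico 0 1) = Measure.dirac 0 +
      (b : ENNReal)⁻¹ • ∑ a ∈ A, ((kempnerMeasure b A).restrict (Set.Ico 0 1)).map
        (fun x => ((a : ℝ) + x) / b) := by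
  ext E hE
  have hm : ∀ a : ℕ, Measurable (fun x : ℝ => ((a : ℝ) + x) / b) := fun a => by fun_prop
  have hb0 : (b : ℝ) ≠ 0 := by positivity
  rw [Measure.add_apply, Measure.smul_apply, Measure.finsetSum_apply, smul_eq_mul,
    kempner_apply b hb A E hE, tsum_eq_zero_add' ENNReal.summable]
  congr 1
  · simp [KS_zero, Measure.dirac_apply' _ hE]
  · have : ∀ a ∈ A, (Measure.map (fun x => ((a : ℝ) + x) / b)
        ((kempnerMeasure b A).restrict (Set.Ico 0 1))) E =
        ∑' l : ℕ, ((b : ENNReal) ^ l)⁻¹ * ∑ n ∈ KS b A l,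
          E.indicator (1 : ℝ → ENNReal) (((a * b ^ l + n : ℕ) : ℝ) / (b : ℝ) ^ (l + 1)) := by
      intro a _
      rw [Measure.map_apply (hm a) hE, kempner_apply b hb A _ (hm a hE)]
      refine tsum_congr fun l => ?_
      congr 1
      refine Finset.sum_congr rfl fun n _ => ?_
      have : (((a * b ^ l + n : ℕ) : ℝ) / (b : ℝ) ^ (l + 1)) = ((a : ℝ) + n / (b : ℝ) ^ l) / b := by
        push_cast; rw [pow_succ]; field_simp
      rw [this]; rfl
    rw [Finset.sum_congr rfl this, ← Summable.tsum_finsetSum (fun _ _ => ENNReal.summable),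
      ← ENNReal.tsum_mul_left]
    refine tsum_congr fun l => ?_
    rw [KS_sum b hb A hA, ← Finset.mul_sum, ← mul_assoc]
    congr 1
    rw [pow_succ, mul_comm, ENNReal.mul_inv (by simp) (by simp)]

theorem kempner_finite (b : ℕ) (hb : 1 < b) (A : Finset ℕ) (hA : ∀ a ∈ A, a < b)
    (hc : A.card < b) : IsFiniteMeasure ((kempnerMeasure b A).restrict (Set.Ico 0 1)) := by
  constructor
  rw [kempner_apply b hb A _ MeasurableSet.univ]
  have : ∀ l : ℕ, ((b : ENNReal) ^ l)⁻¹ * ∑ n ∈ KS b A l,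
      (Set.univ : Set ℝ).indicator (1 : ℝ → ENNReal) ((n : ℝ) / (b : ℝ) ^ l) =
      ((A.card : ENNReal) / b) ^ l := by
    intro l
    simp only [Set.indicator_univ, Pi.one_apply, Finset.sum_const, nsmul_eq_mul, mul_one]
    rw [KS_card b hb A hA, ENNReal.div_eq_inv_mul, mul_pow, ENNReal.inv_pow]
  rw [tsum_congr this, ENNReal.tsum_geometric, ENNReal.inv_lt_top, tsub_pos_iff_lt]
  refine ENNReal.div_lt_of_lt_mul ?_
  rw [one_mul]; exact_mod_cast hc

theorem kempner_functional_identity (b : ℕ) (hb : 1 < b) (A : Finset ℕ)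
    (hA : A ⊂ Finset.range b) (hAne : A.Nonempty) (hA0 : A ≠ {0})
    (f : ℝ → ℝ) (hf : ContinuousOn f (Set.Ico (0 : ℝ) (b : ℝ)))
    (hbd : ∃ C : ℝ, ∀ x ∈ Set.Ico (0 : ℝ) (b : ℝ), |f x| ≤ C) :
    ∫ x in Set.Ico (0 : ℝ) 1, f ((b : ℝ) * x) ∂(kempnerMeasure b A)
      = f 0 + (b : ℝ)⁻¹ *
          ∑ a ∈ A, ∫ x in Set.Ico (0 : ℝ) 1, f ((a : ℝ) + x) ∂(kempnerMeasure b A) := by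
  have hAb : ∀ a ∈ A, a < b := fun a ha => Finset.mem_range.1 (hA.1 ha)
  have hc : A.card < b := by simpa using Finset.card_lt_card hA
  have hbpos : (0 : ℝ) < b := by positivity
  have := kempner_finite b hb A hAb hc
  obtain ⟨C, hC⟩ := hbd
  set g : ℝ → ℝ := (Set.Ico (0 : ℝ) b).indicator f with hg
  have hgm : Measurable g := by
    have := hf.measurable_piecewise (g := fun _ => (0 : ℝ)) continuousOn_const measurableSet_Ico
    rw [hg]
    convert this using 1
    ext x
    by_cases hx : x ∈ Set.Ico (0 : ℝ) b
    · rw [Set.indicator_of_mem hx, Set.piecewise_eq_of_mem _ _ _ hx]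
    · rw [Set.indicator_of_notMem hx, Set.piecewise_eq_of_notMem _ _ _ hx]
  have hgC : ∀ x, ‖g x‖ ≤ C := by
    intro x
    by_cases hx : x ∈ Set.Ico (0 : ℝ) b
    · rw [hg, Set.indicator_of_mem hx]; exact hC x hx
    · rw [hg, Set.indicator_of_notMem hx, norm_zero]
      exact (abs_nonneg _).trans (hC 0 ⟨le_rfl, hbpos⟩)
  have hL : ∫ x in Set.Ico (0 : ℝ) 1, f ((b : ℝ) * x) ∂(kempnerMeasure b A) =
      ∫ x in Set.Ico (0 : ℝ) 1, g ((b : ℝ) * x) ∂(kempnerMeasure b A) := by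
    refine setIntegral_congr_fun measurableSet_Ico fun x hx => ?_
    have : (b : ℝ) * x ∈ Set.Ico (0 : ℝ) b :=
      ⟨mul_nonneg hbpos.le hx.1, by nlinarith [hx.2]⟩
    simp only [hg, Set.indicator_of_mem this]
  have hR : ∀ a ∈ A, ∫ x in Set.Ico (0 : ℝ) 1, f ((a : ℝ) + x) ∂(kempnerMeasure b A) =
      ∫ x in Set.Ico (0 : ℝ) 1, g ((a : ℝ) + x) ∂(kempnerMeasure b A) := by
    intro a ha
    refine setIntegral_congr_fun measurableSet_Ico fun x hx => ?_
    have h1 : ((a : ℝ) + 1) ≤ b := by exact_mod_cast hAb a ha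
    have : (a : ℝ) + x ∈ Set.Ico (0 : ℝ) b :=
      ⟨add_nonneg (Nat.cast_nonneg _) hx.1, by linarith [hx.2]⟩
    simp only [hg, Set.indicator_of_mem this]
  have h0 : f 0 = g 0 := by
    rw [hg, Set.indicator_of_mem]; exact ⟨le_rfl, hbpos⟩
  rw [hL, Finset.sum_congr rfl hR, h0]
  have hgb : Measurable (fun x => g ((b : ℝ) * x)) := hgm.comp (measurable_const_mul _)
  have hint : ∀ (ν : Measure ℝ) [IsFiniteMeasure ν], Integrable (fun x => g ((b : ℝ) * x)) ν :=
    fun ν _ => Integrable.of_bound hgb.aestronglyMeasurable C (Filter.Eventually.of_forall fun x => hgC _)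
  have hm : ∀ a : ℕ, Measurable (fun x : ℝ => ((a : ℝ) + x) / b) := fun a => by fun_prop
  have hmap : ∀ a ∈ A, Integrable (fun x => g ((b : ℝ) * x))
      (((kempnerMeasure b A).restrict (Set.Ico 0 1)).map (fun x => ((a : ℝ) + x) / b)) :=
    fun a _ => hint _
  conv_lhs => rw [kempner_fixed b hb A hAb]
  rw [integral_add_measure (hint _), integral_smul_measure,
    integral_finsetSum_measure hmap, integral_dirac]
  · simp only [mul_zero, smul_eq_mul, ENNReal.toReal_inv, ENNReal.toReal_natCast]
    congr 2
    refine Finset.sum_congr rfl fun a _ => ?_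
    rw [integral_map (hm a).aemeasurable hgb.aestronglyMeasurable]
    refine integral_congr_ae (Filter.Eventually.of_forall fun x => ?_)
    simp only
    congr 1
    field_simp
  · refine Integrable.smul_measure ?_ (by simp; omega)
    exact integrable_finsetSum_measure.2 hmap
end

section
/- The moments satisfy the linear recurrence: for every m ≥ 1, (b^{m+1} − N) u_m = Σ_{j=1}^{m} C(m,j) γ_j u_{m−j}, where C(m,j) is the binomial coefficient and γ_j = Σ_{a∈A} a^j. -/
open MeasureTheory

def kT (b : ℕ) (A : Finset ℕ) (l : ℕ) : Finset ℕ :=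
  (Finset.range (b ^ l)).filter (fun n => ∀ i < l, n / b ^ i % b ∈ A)

noncomputable def kS (b : ℕ) (A : Finset ℕ) (l m : ℕ) : ℝ :=
  ∑ n ∈ kT b A l, ((n : ℝ) / (b : ℝ) ^ l) ^ m

theorem mem_kT {b : ℕ} {A : Finset ℕ} {l n : ℕ} :
    n ∈ kT b A l ↔ n < b ^ l ∧ ∀ i < l, n / b ^ i % b ∈ A := by
  simp [kT]

theorem kmod_digit (b l i n : ℕ) (hi : i < l) :
    (n % b ^ l) / b ^ i % b = n / b ^ i % b := by
  obtain ⟨k, rfl⟩ := Nat.exists_eq_add_of_lt hi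
  have : b ^ (i + k + 1) = b ^ i * (b * b ^ k) := by ring
  rw [this, Nat.mod_mul_right_div_self, Nat.mod_mul_right_mod]

theorem kT_sum {b : ℕ} (hb : 1 < b) {A : Finset ℕ} (hA : A ⊂ Finset.range b) (l : ℕ)
    (f : ℕ → ℝ) :
    ∑ n ∈ kT b A (l + 1), f n = ∑ a ∈ A, ∑ n ∈ kT b A l, f (a * b ^ l + n) := by
  have hpos : 0 < b ^ l := Nat.pow_pos (by omega)
  rw [← Finset.sum_product']
  symm
  refine Finset.sum_nbij' (fun p => p.1 * b ^ l + p.2) (fun n => (n / b ^ l, n % b ^ l))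
    ?_ ?_ ?_ ?_ ?_
  · rintro ⟨a, n⟩ h
    simp only [Finset.mem_product, mem_kT] at h ⊢
    obtain ⟨ha, hn, hd⟩ := h
    have hab : a < b := by simpa using hA.1 ha
    have hmod : (a * b ^ l + n) % b ^ l = n := by
      rw [mul_comm, Nat.mul_add_mod, Nat.mod_eq_of_lt hn]
    have hdiv : (a * b ^ l + n) / b ^ l = a := by
      rw [mul_comm, Nat.mul_add_div hpos, Nat.div_eq_of_lt hn, add_zero]
    refine ⟨?_, ?_⟩
    · rw [pow_succ']
      calc a * b ^ l + n < (a + 1) * b ^ l := by rw [add_mul]; omega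
        _ ≤ b * b ^ l := Nat.mul_le_mul_right _ hab
    · intro i hi
      rcases Nat.lt_succ_iff_lt_or_eq.1 hi with h | rfl
      · rw [← kmod_digit b l i _ h, hmod]; exact hd i h
      · rw [hdiv, Nat.mod_eq_of_lt hab]; exact ha
  · intro n h
    simp only [Finset.mem_product, mem_kT] at h ⊢
    obtain ⟨hn, hd⟩ := h
    refine ⟨?_, Nat.mod_lt _ hpos, fun i hi => ?_⟩
    · have := hd l (by omega)
      rwa [Nat.mod_eq_of_lt] at this
      rw [Nat.div_lt_iff_lt_mul hpos]
      rwa [pow_succ'] at hn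
    · rw [kmod_digit b l i n hi]; exact hd i (by omega)
  · rintro ⟨a, n⟩ h
    simp only [Finset.mem_product, mem_kT] at h ⊢
    obtain ⟨ha, hn, hd⟩ := h
    ext
    · simp only
      rw [mul_comm, Nat.mul_add_div hpos, Nat.div_eq_of_lt hn, add_zero]
    · simp only
      rw [mul_comm, Nat.mul_add_mod, Nat.mod_eq_of_lt hn]
  · intro n h
    simp only
    exact Nat.div_add_mod' n (b ^ l)
  · intro p h
    rfl

theorem kT_zero (b : ℕ) (A : Finset ℕ) : kT b A 0 = {0} := by
  ext n; simp [mem_kT]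

theorem kS_zero (b : ℕ) (A : Finset ℕ) {m : ℕ} (hm : 1 ≤ m) : kS b A 0 m = 0 := by
  simp [kS, kT_zero]; omega

theorem kT_card {b : ℕ} (hb : 1 < b) {A : Finset ℕ} (hA : A ⊂ Finset.range b) (l : ℕ) :
    ((kT b A l).card : ℝ) = (A.card : ℝ) ^ l := by
  induction l with
  | zero => simp [kT_zero]
  | succ l ih =>
    have := kT_sum hb hA l (fun _ => 1)
    simp only [Finset.sum_const, nsmul_eq_mul, mul_one] at this
    rw [this, ih, pow_succ']

theorem kS_nonneg (b : ℕ) (A : Finset ℕ) (l m : ℕ) : 0 ≤ kS b A l m :=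
  Finset.sum_nonneg fun n _ => by positivity

theorem kS_le {b : ℕ} (hb : 1 < b) {A : Finset ℕ} (hA : A ⊂ Finset.range b) (l m : ℕ) :
    kS b A l m ≤ (A.card : ℝ) ^ l := by
  rw [← kT_card hb hA]
  have hb0 : (0 : ℝ) < (b : ℝ) ^ l := by positivity
  calc kS b A l m ≤ ∑ n ∈ kT b A l, (1 : ℝ) := by
        refine Finset.sum_le_sum fun n hn => ?_
        refine pow_le_one₀ (by positivity) ?_
        rw [div_le_one hb0]
        exact_mod_cast (mem_kT.1 hn).1.le
    _ = _ := by simp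

theorem kS_summable {b : ℕ} (hb : 1 < b) {A : Finset ℕ} (hA : A ⊂ Finset.range b) (m : ℕ) :
    Summable (fun l => ((b : ℝ) ^ l)⁻¹ * kS b A l m) := by
  have hb0 : (0 : ℝ) < b := by positivity
  have hlt : (A.card : ℝ) < b := by
    have := Finset.card_lt_card hA
    rw [Finset.card_range] at this
    exact_mod_cast this
  refine Summable.of_nonneg_of_le
    (fun l => mul_nonneg (by positivity) (kS_nonneg b A l m)) (fun l => ?_)
    (summable_geometric_of_lt_one (r := (A.card : ℝ) / b) (by positivity)
      ((div_lt_one hb0).2 hlt))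
  rw [div_pow, div_eq_inv_mul]
  exact mul_le_mul_of_nonneg_left (kS_le hb hA l m) (by positivity)

theorem kS_succ {b : ℕ} (hb : 1 < b) {A : Finset ℕ} (hA : A ⊂ Finset.range b) (l m : ℕ) :
    (b : ℝ) ^ m * kS b A (l + 1) m
      = ∑ j ∈ Finset.range (m + 1),
          (m.choose j : ℝ) * (∑ a ∈ A, (a : ℝ) ^ j) * kS b A l (m - j) := by
  have hb0 : (b : ℝ) ≠ 0 := by positivity
  unfold kS
  rw [kT_sum hb hA, Finset.mul_sum]
  have key : ∀ a n : ℕ, (b : ℝ) ^ m * (((a * b ^ l + n : ℕ) : ℝ) / (b : ℝ) ^ (l + 1)) ^ m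
      = ∑ j ∈ Finset.range (m + 1),
        (m.choose j : ℝ) * ((a : ℝ) ^ j * ((n : ℝ) / (b : ℝ) ^ l) ^ (m - j)) := by
    intro a n
    rw [← mul_pow]
    have : (b : ℝ) * (((a * b ^ l + n : ℕ) : ℝ) / (b : ℝ) ^ (l + 1))
        = (a : ℝ) + (n : ℝ) / (b : ℝ) ^ l := by
      push_cast
      rw [pow_succ]
      field_simp
    rw [this, add_pow]
    exact Finset.sum_congr rfl fun j _ => by ring
  simp_rw [Finset.mul_sum, key]
  have h1 : ∀ a ∈ A, ∑ n ∈ kT b A l, ∑ j ∈ Finset.range (m + 1),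
        (m.choose j : ℝ) * ((a : ℝ) ^ j * ((n : ℝ) / (b : ℝ) ^ l) ^ (m - j))
      = ∑ j ∈ Finset.range (m + 1), ∑ n ∈ kT b A l,
        (m.choose j : ℝ) * ((a : ℝ) ^ j * ((n : ℝ) / (b : ℝ) ^ l) ^ (m - j)) :=
    fun a _ => Finset.sum_comm
  rw [Finset.sum_congr rfl h1, Finset.sum_comm]
  refine Finset.sum_congr rfl fun j _ => ?_
  simp only [← Finset.mul_sum, ← Finset.sum_mul]
  ring

theorem kdigits {b : ℕ} (hb : 1 < b) (A : Finset ℕ) (n : ℕ) :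
    (∀ d ∈ Nat.digits b n, d ∈ A) ↔ ∀ i < (Nat.digits b n).length, n / b ^ i % b ∈ A := by
  rw [List.forall_mem_iff_forall_getElem]
  refine forall_congr' fun i => forall_congr' fun hi => ?_
  rw [← Nat.getD_digits n i hb, List.getD_eq_getElem _ _ hi]

theorem kadm_zero_mem {b : ℕ} (hb : 1 < b) {A : Finset ℕ} (h0 : 0 ∈ A) (l n : ℕ) :
    (Admissible b A n ∧ n < b ^ l) ↔ n ∈ kT b A l := by
  rw [mem_kT, and_comm]
  refine and_congr_right fun hn => ?_
  unfold Admissible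
  rw [kdigits hb]
  have hl := (Nat.digits_length_le_iff hb n).2 hn
  constructor
  · rintro ⟨h, -⟩ i hi
    by_cases hc : i < (Nat.digits b n).length
    · exact h i hc
    · have : n < b ^ i := (Nat.digits_length_le_iff hb n).1 (by omega)
      rw [Nat.div_eq_of_lt this, Nat.zero_mod]; exact h0
  · intro h
    exact ⟨fun i hi => h i (by omega), fun _ => h0⟩

theorem kadm_zero_not_mem {b : ℕ} (hb : 1 < b) {A : Finset ℕ} (h0 : 0 ∉ A) (l n : ℕ) :
    ((Admissible b A n ∧ l + 1 ≤ (Nat.digits b n).length) ∧ n < b ^ (l + 1))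
      ↔ n ∈ kT b A (l + 1) := by
  rw [mem_kT, and_comm]
  refine and_congr_right fun hn => ?_
  unfold Admissible
  rw [kdigits hb]
  have hl := (Nat.digits_length_le_iff hb n).2 hn
  constructor
  · rintro ⟨⟨h, -⟩, h2⟩ i hi
    exact h i (by omega)
  · intro h
    have h2 : l + 1 ≤ (Nat.digits b n).length := by
      by_contra hc
      have : n < b ^ l := (Nat.digits_length_le_iff hb n).1 (by omega)
      have h3 := h l (by omega)
      rw [Nat.div_eq_of_lt this, Nat.zero_mod] at h3
      exact h0 h3
    refine ⟨⟨fun i hi => h i (by omega), ?_⟩, h2⟩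
    rintro rfl
    simp at h2

theorem klevel {b : ℕ} (hb : 1 < b) (A : Finset ℕ) (l m : ℕ) (P : ℕ → Prop)
    (hP : ∀ n, (P n ∧ n < b ^ l) ↔ n ∈ kT b A l) :
    ∑' n : {n : ℕ // P n}, (Set.Ico (0 : ℝ) 1).indicator (fun x => ENNReal.ofReal (x ^ m))
        (((n : ℕ) : ℝ) / (b : ℝ) ^ l) = ENNReal.ofReal (kS b A l m) := by
  have hb0 : (0 : ℝ) < (b : ℝ) ^ l := by positivity
  have hmem : ∀ n : ℕ, ((n : ℝ) / (b : ℝ) ^ l) ∈ Set.Ico (0 : ℝ) 1 ↔ n < b ^ l := by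
    intro n
    rw [Set.mem_Ico, div_lt_one hb0]
    constructor
    · rintro ⟨-, h⟩; exact_mod_cast h
    · intro h; exact ⟨by positivity, by exact_mod_cast h⟩
  have h1 := tsum_subtype {n : ℕ | P n} (fun n : ℕ =>
    (Set.Ico (0 : ℝ) 1).indicator (fun x => ENNReal.ofReal (x ^ m)) ((n : ℝ) / (b : ℝ) ^ l))
  refine h1.trans ?_
  rw [tsum_eq_sum (s := kT b A l), kS, ENNReal.ofReal_sum_of_nonneg]
  · refine Finset.sum_congr rfl fun n hn => ?_
    have := (hP n).2 hn
    rw [Set.indicator_of_mem (show n ∈ {n | P n} from this.1),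
      Set.indicator_of_mem ((hmem n).2 this.2)]
  · intro n _; positivity
  · intro n hn
    by_cases hp : P n
    · rw [Set.indicator_of_mem (show n ∈ {n | P n} from hp), Set.indicator_of_notMem]
      rw [hmem]
      exact fun h => hn ((hP n).1 ⟨hp, h⟩)
    · exact Set.indicator_of_notMem hp _

theorem klint {b : ℕ} (hb : 1 < b) (A : Finset ℕ) (m : ℕ) :
    ∫⁻ x in Set.Ico (0 : ℝ) 1, ENNReal.ofReal (x ^ m) ∂(kempnerMeasure b A)
      = ∑' l : ℕ, ((b : ENNReal) ^ l)⁻¹ * ENNReal.ofReal (kS b A l m) := by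
  rw [← lintegral_indicator measurableSet_Ico]
  unfold kempnerMeasure
  split_ifs with h0
  · rw [lintegral_sum_measure]
    refine tsum_congr fun l => ?_
    rw [lintegral_smul_measure, lintegral_sum_measure, smul_eq_mul]
    simp_rw [lintegral_dirac]
    rw [klevel hb A l m _ (kadm_zero_mem hb h0 l)]
  · rw [lintegral_add_measure, lintegral_dirac, lintegral_sum_measure]
    rw [tsum_eq_zero_add' ENNReal.summable, tsum_eq_zero_add'
      (f := fun l : ℕ => ((b : ENNReal) ^ l)⁻¹ * ENNReal.ofReal (kS b A l m)) ENNReal.summable]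
    simp_rw [lintegral_smul_measure, lintegral_sum_measure, smul_eq_mul, lintegral_dirac]
    have e : ∑' n : {n : ℕ // Admissible b A n ∧ 0 ≤ (Nat.digits b n).length},
        (Set.Ico (0 : ℝ) 1).indicator (fun x => ENNReal.ofReal (x ^ m))
        (((n : ℕ) : ℝ) / (b : ℝ) ^ 0) = 0 := by
      rw [ENNReal.tsum_eq_zero]
      rintro ⟨n, ⟨hn, hn0⟩, -⟩
      apply Set.indicator_of_notMem
      have : 1 ≤ n := by
        rcases Nat.eq_zero_or_pos n with h | h
        · exact absurd (hn0 h) h0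
        · exact h
      have : (1 : ℝ) ≤ n := by exact_mod_cast this
      rw [pow_zero, div_one]
      exact fun h => absurd h.2 (not_lt.2 this)
    rw [e, mul_zero, zero_add]
    congr 1
    · simp [kS, kT_zero]
    · refine tsum_congr fun l => ?_
      rw [klevel hb A (l + 1) m _ (kadm_zero_not_mem hb h0 l)]

theorem kmoment {b : ℕ} (hb : 1 < b) {A : Finset ℕ} (hA : A ⊂ Finset.range b) (m : ℕ) :
    moment b A m = ∑' l : ℕ, ((b : ℝ) ^ l)⁻¹ * kS b A l m := by
  have hb0 : (0 : ℝ) < b := by positivity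
  have hnn : ∀ l, 0 ≤ ((b : ℝ) ^ l)⁻¹ * kS b A l m :=
    fun l => mul_nonneg (by positivity) (kS_nonneg b A l m)
  unfold moment
  rw [integral_eq_lintegral_of_nonneg_ae, klint hb A m]
  · rw [← ENNReal.toReal_ofReal (tsum_nonneg hnn),
      ENNReal.ofReal_tsum_of_nonneg hnn (kS_summable hb hA m)]
    congr 1
    refine tsum_congr fun l => ?_
    rw [ENNReal.ofReal_mul (by positivity), ENNReal.ofReal_inv_of_pos (by positivity),
      ENNReal.ofReal_pow hb0.le, ENNReal.ofReal_natCast]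
  · refine ae_restrict_of_forall_mem measurableSet_Ico fun x hx => ?_
    exact pow_nonneg hx.1 m
  · exact (by fun_prop : Continuous fun x : ℝ => x ^ m).aestronglyMeasurable

theorem kempner_moment_recurrence (b : ℕ) (hb : 1 < b) (A : Finset ℕ)
    (hA : A ⊂ Finset.range b) (hAne : A.Nonempty) (hA0 : A ≠ {0})
    (m : ℕ) (hm : 1 ≤ m) :
    ((b : ℝ) ^ (m + 1) - (A.card : ℝ)) * moment b A m
      = ∑ j ∈ Finset.Icc 1 m,
          (m.choose j : ℝ) * (∑ a ∈ A, (a : ℝ) ^ j) * moment b A (m - j) := by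
  have hb0 : (b : ℝ) ≠ 0 := by positivity
  have main : (b : ℝ) ^ (m + 1) * moment b A m
      = ∑ j ∈ Finset.range (m + 1),
          (m.choose j : ℝ) * (∑ a ∈ A, (a : ℝ) ^ j) * moment b A (m - j) := by
    simp_rw [kmoment hb hA]
    rw [(kS_summable hb hA m).tsum_eq_zero_add, kS_zero b A hm, mul_zero, zero_add,
      ← tsum_mul_left]
    simp_rw [← tsum_mul_left]
    rw [← Summable.tsum_finsetSum fun j _ => (kS_summable hb hA (m - j)).mul_left _]
    refine tsum_congr fun l => ?_
    have := kS_succ hb hA l m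
    calc (b : ℝ) ^ (m + 1) * (((b : ℝ) ^ (l + 1))⁻¹ * kS b A (l + 1) m)
        = ((b : ℝ) ^ l)⁻¹ * ((b : ℝ) ^ m * kS b A (l + 1) m) := by
          rw [pow_succ, pow_succ]; field_simp
      _ = _ := by
        rw [this, Finset.mul_sum]
        exact Finset.sum_congr rfl fun j _ => by ring
  rw [sub_mul, main, Finset.sum_range_succ']
  have h2 : ∑ j ∈ Finset.Icc 1 m,
          (m.choose j : ℝ) * (∑ a ∈ A, (a : ℝ) ^ j) * moment b A (m - j)
      = ∑ j ∈ Finset.range m, (m.choose (j + 1) : ℝ) * (∑ a ∈ A, (a : ℝ) ^ (j + 1))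
          * moment b A (m - (j + 1)) := by
    rw [Finset.range_eq_Ico, Finset.sum_Ico_add' (fun j => (m.choose j : ℝ) *
      (∑ a ∈ A, (a : ℝ) ^ j) * moment b A (m - j)) 0 m 1]
    rfl
  rw [h2]
  simp
end

section
/- The normalized quantities λ_m satisfy, for every m ≥ 2, the recurrence (b^m − N) λ_m = Σ_{j=1}^{m−1} C(m,j) (γ_j / f^j) (b−1)^j λ_{m−j}, where C(m,j) is the binomial coefficient and γ_j = Σ_{a∈A} a^j. -/
open MeasureTheory

noncomputable def kempnerLambda (b : ℕ) (A : Finset ℕ) (hAne : A.Nonempty) (m : ℕ) : ℝ :=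
  (m : ℝ) * (((b : ℝ) - 1) / ((A.max' hAne : ℕ) : ℝ)) ^ (m - 1)
    * moment b A (m - 1) / moment b A 0

/-- Numbers whose `l` (padded) digits all lie in `A`. -/
def KF (b : ℕ) (A : Finset ℕ) (l : ℕ) : Finset ℕ :=
  (Finset.range (b ^ l)).filter fun n => ∀ i < l, n / b ^ i % b ∈ A

theorem mem_KF {b : ℕ} {A : Finset ℕ} {l n : ℕ} :
    n ∈ KF b A l ↔ n < b ^ l ∧ ∀ i < l, n / b ^ i % b ∈ A := by
  simp [KF]

theorem digit_low {b l i a k : ℕ} (hb : 1 < b) (hi : i < l) :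
    (a * b ^ l + k) / b ^ i % b = k / b ^ i % b := by
  obtain ⟨c, rfl⟩ : ∃ c, l = i + 1 + c := ⟨l - (i + 1), by omega⟩
  have h : a * b ^ (i + 1 + c) + k = k + b ^ i * (b * (a * b ^ c)) := by ring
  have hpos : 0 < b ^ i := by positivity
  rw [h, Nat.add_mul_div_left _ _ hpos, Nat.add_mul_mod_self_left]

theorem KF_sum_succ {b : ℕ} (hb : 1 < b) {A : Finset ℕ} (hA : A ⊆ Finset.range b) (l : ℕ)
    (g : ℕ → ℝ) :
    ∑ n ∈ KF b A (l + 1), g n = ∑ a ∈ A, ∑ k ∈ KF b A l, g (a * b ^ l + k) := by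
  have hpos : 0 < b ^ l := by positivity
  rw [← Finset.sum_product' A (KF b A l) (fun a k => g (a * b ^ l + k))]
  symm
  refine Finset.sum_nbij' (fun p => p.1 * b ^ l + p.2) (fun n => (n / b ^ l, n % b ^ l))
    ?_ ?_ ?_ ?_ ?_
  · rintro ⟨a, k⟩ h
    simp only [Finset.mem_product, mem_KF] at h ⊢
    obtain ⟨ha, hk, hd⟩ := h
    have hab : a < b := Finset.mem_range.1 (hA ha)
    refine ⟨?_, fun i hi => ?_⟩
    · calc a * b ^ l + k < a * b ^ l + b ^ l := by omega
        _ = (a + 1) * b ^ l := by ring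
        _ ≤ b * b ^ l := Nat.mul_le_mul_right _ hab
        _ = b ^ (l + 1) := by ring
    · rcases Nat.lt_succ_iff_lt_or_eq.1 hi with h | rfl
      · rw [digit_low hb h]; exact hd i h
      · have : (a * b ^ i + k) / b ^ i = a := by
          rw [add_comm, Nat.add_mul_div_right _ _ hpos, Nat.div_eq_of_lt hk, zero_add]
        rw [this, Nat.mod_eq_of_lt hab]; exact ha
  · intro n h
    simp only [Finset.mem_product, mem_KF] at h ⊢
    obtain ⟨hn, hd⟩ := h
    have h1 : n / b ^ l < b := Nat.div_lt_of_lt_mul (by rwa [pow_succ] at hn)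
    refine ⟨?_, Nat.mod_lt _ hpos, fun i hi => ?_⟩
    · have := hd l (Nat.lt_succ_self l)
      rwa [Nat.mod_eq_of_lt h1] at this
    · have := hd i (by omega)
      rw [← Nat.div_add_mod' n (b ^ l), digit_low hb hi] at this
      exact this
  · rintro ⟨a, k⟩ h
    simp only [Finset.mem_product, mem_KF] at h
    obtain ⟨ha, hk, hd⟩ := h
    simp only [Prod.mk.injEq]
    refine ⟨?_, ?_⟩
    · rw [add_comm, Nat.add_mul_div_right _ _ hpos, Nat.div_eq_of_lt hk, zero_add]
    · rw [add_comm, Nat.add_mul_mod_self_right, Nat.mod_eq_of_lt hk]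
  · intro n _
    exact Nat.div_add_mod' n (b ^ l)
  · intro p _
    rfl

theorem KF_zero {b : ℕ} {A : Finset ℕ} : KF b A 0 = {0} := by
  ext n; simp [mem_KF]

theorem admissible_iff {b : ℕ} (hb : 1 < b) {A : Finset ℕ} {n : ℕ} :
    Admissible b A n ↔
      (∀ i < (Nat.digits b n).length, n / b ^ i % b ∈ A) ∧ (n = 0 → 0 ∈ A) := by
  unfold Admissible
  refine and_congr_left fun _ => ?_
  rw [List.forall_mem_iff_getElem]
  refine forall_congr' fun i => forall_congr' fun hi => ?_
  rw [← Nat.getD_digits n i (by omega), List.getD_eq_getElem _ _ hi]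

theorem mem_KF_of_zero_mem {b : ℕ} (hb : 1 < b) {A : Finset ℕ} (h0 : 0 ∈ A) {l n : ℕ} :
    n ∈ KF b A l ↔ Admissible b A n ∧ n < b ^ l := by
  rw [mem_KF, admissible_iff hb]
  constructor
  · rintro ⟨hn, h⟩
    refine ⟨⟨fun i hi => h i (hi.trans_le ((Nat.digits_length_le_iff hb n).2 hn)), fun _ => h0⟩, hn⟩
  · rintro ⟨⟨h, _⟩, hn⟩
    refine ⟨hn, fun i _ => ?_⟩
    by_cases hi : i < (Nat.digits b n).length
    · exact h i hi
    · rw [← Nat.getD_digits n i (by omega), List.getD_eq_default _ _ (by omega)]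
      exact h0

theorem mem_KF_of_zero_notMem {b : ℕ} (hb : 1 < b) {A : Finset ℕ} (h0 : 0 ∉ A) {l n : ℕ} :
    n ∈ KF b A (l + 1) ↔
      (Admissible b A n ∧ l + 1 ≤ (Nat.digits b n).length) ∧ n < b ^ (l + 1) := by
  rw [mem_KF, admissible_iff hb]
  constructor
  · rintro ⟨hn, h⟩
    refine ⟨⟨⟨fun i hi => h i (hi.trans_le ((Nat.digits_length_le_iff hb n).2 hn)), ?_⟩, ?_⟩, hn⟩
    · rintro rfl
      simpa using h 0 (by omega)
    · by_contra hlt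
      have := h l (by omega)
      rw [← Nat.getD_digits n l (by omega), List.getD_eq_default _ _ (by omega)] at this
      exact h0 this
  · rintro ⟨⟨⟨h, _⟩, hl⟩, hn⟩
    exact ⟨hn, fun i hi => h i (by omega)⟩

noncomputable def KT (b : ℕ) (A : Finset ℕ) (m l : ℕ) : ℝ :=
  ((b : ℝ) ^ l)⁻¹ * ∑ n ∈ KF b A l, ((n : ℝ) / (b : ℝ) ^ l) ^ m

theorem KT_nonneg (b : ℕ) (A : Finset ℕ) (m l : ℕ) : 0 ≤ KT b A m l := by
  unfold KT; positivity

theorem KT_zero (b : ℕ) (A : Finset ℕ) (m : ℕ) (hm : m ≠ 0) : KT b A m 0 = 0 := by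
  simp [KT, KF_zero, hm]

theorem KT_succ {b : ℕ} (hb : 1 < b) {A : Finset ℕ} (hA : A ⊆ Finset.range b) (m l : ℕ) :
    (b : ℝ) ^ (m + 1) * KT b A m (l + 1) =
      ∑ j ∈ Finset.range (m + 1), (m.choose j : ℝ) * (∑ a ∈ A, (a : ℝ) ^ j) * KT b A (m - j) l := by
  have hb0 : (b : ℝ) ≠ 0 := by positivity
  unfold KT
  rw [KF_sum_succ hb hA]
  have key : ∀ a k : ℕ, (((a * b ^ l + k : ℕ) : ℝ) / (b : ℝ) ^ (l + 1)) ^ m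
      = ((b : ℝ) ^ m)⁻¹ * ∑ j ∈ Finset.range (m + 1),
        (a : ℝ) ^ j * ((k : ℝ) / (b : ℝ) ^ l) ^ (m - j) * (m.choose j : ℝ) := by
    intro a k
    rw [← add_pow, ← inv_pow, ← mul_pow]
    congr 1
    push_cast
    rw [pow_succ]
    field_simp
  simp_rw [key, ← Finset.mul_sum]
  have : (b : ℝ) ^ (m + 1) * (((b : ℝ) ^ (l + 1))⁻¹ * (((b : ℝ) ^ m)⁻¹ *
      ∑ a ∈ A, ∑ k ∈ KF b A l, ∑ j ∈ Finset.range (m + 1),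
        (a : ℝ) ^ j * ((k : ℝ) / (b : ℝ) ^ l) ^ (m - j) * (m.choose j : ℝ)))
      = ((b : ℝ) ^ l)⁻¹ * ∑ a ∈ A, ∑ k ∈ KF b A l, ∑ j ∈ Finset.range (m + 1),
        (a : ℝ) ^ j * ((k : ℝ) / (b : ℝ) ^ l) ^ (m - j) * (m.choose j : ℝ) := by
    rw [pow_succ, pow_succ]
    field_simp
  rw [this]
  have h2 : ∑ a ∈ A, ∑ k ∈ KF b A l, ∑ j ∈ Finset.range (m + 1),
        (a : ℝ) ^ j * ((k : ℝ) / (b : ℝ) ^ l) ^ (m - j) * (m.choose j : ℝ)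
      = ∑ j ∈ Finset.range (m + 1), ∑ a ∈ A, ∑ k ∈ KF b A l,
        (a : ℝ) ^ j * ((k : ℝ) / (b : ℝ) ^ l) ^ (m - j) * (m.choose j : ℝ) := by
    rw [Finset.sum_comm]
    simp_rw [Finset.sum_comm (s := A)]
    rw [Finset.sum_comm]
  rw [h2, Finset.mul_sum]
  refine Finset.sum_congr rfl fun j _ => ?_
  simp_rw [← Finset.sum_mul, ← Finset.mul_sum, ← Finset.sum_mul]
  ring

theorem KF_card {b : ℕ} (hb : 1 < b) {A : Finset ℕ} (hA : A ⊆ Finset.range b) (l : ℕ) :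
    ((KF b A l).card : ℝ) = (A.card : ℝ) ^ l := by
  induction l with
  | zero => simp [KF_zero]
  | succ l ih =>
    have := KF_sum_succ hb hA l (fun _ => 1)
    simp only [Finset.sum_const, nsmul_eq_mul, mul_one] at this
    rw [this, ih, pow_succ']

theorem KT_summable {b : ℕ} (hb : 1 < b) {A : Finset ℕ} (hA : A ⊂ Finset.range b) (m : ℕ) :
    Summable (KT b A m) := by
  have hcard : (A.card : ℝ) < b := by
    have := Finset.card_lt_card hA
    rw [Finset.card_range] at this
    exact_mod_cast this
  have hb0 : (0 : ℝ) < b := by positivity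
  refine Summable.of_nonneg_of_le (KT_nonneg b A m) (fun l => ?_)
    (summable_geometric_of_lt_one (r := (A.card : ℝ) / b) (by positivity)
      ((div_lt_one hb0).2 hcard))
  unfold KT
  rw [div_pow, ← KF_card hb hA.1, div_eq_inv_mul]
  gcongr
  rw [Finset.card_eq_sum_ones]
  push_cast
  refine Finset.sum_le_sum fun n hn => ?_
  refine pow_le_one₀ (by positivity) ?_
  rw [div_le_one (by positivity)]
  exact_mod_cast (mem_KF.1 hn).1.le

/-- collapse of the indicator sum -/
theorem tsum_ind {b l : ℕ} (hb : 1 < b) (m : ℕ) (P : ℕ → Prop) (F : Finset ℕ)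
    (hF : ∀ n, n ∈ F ↔ P n ∧ n < b ^ l) :
    ∑' n : {n : ℕ // P n}, (Set.Ico (0 : ℝ) 1).indicator (fun x => ENNReal.ofReal (x ^ m))
      (((n : ℕ) : ℝ) / (b : ℝ) ^ l)
      = ENNReal.ofReal (∑ n ∈ F, ((n : ℝ) / (b : ℝ) ^ l) ^ m) := by
  have hb0 : (0 : ℝ) < (b : ℝ) ^ l := by positivity
  rw [ENNReal.ofReal_sum_of_nonneg (fun _ _ => by positivity)]
  have h := tsum_subtype {n : ℕ | P n} (fun n : ℕ =>
    (Set.Ico (0 : ℝ) 1).indicator (fun x => ENNReal.ofReal (x ^ m)) ((n : ℝ) / (b : ℝ) ^ l))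
  refine h.trans ?_
  rw [tsum_eq_sum (s := F)]
  · refine Finset.sum_congr rfl fun n hn => ?_
    obtain ⟨hP, hlt⟩ := (hF n).1 hn
    rw [Set.indicator_of_mem (by exact hP), Set.indicator_of_mem]
    refine ⟨by positivity, ?_⟩
    rw [div_lt_one hb0]
    exact_mod_cast hlt
  · intro n hn
    by_cases hP : P n
    · rw [Set.indicator_of_mem (by exact hP), Set.indicator_of_notMem]
      rintro ⟨_, h1⟩
      rw [div_lt_one hb0] at h1
      exact hn ((hF n).2 ⟨hP, by exact_mod_cast h1⟩)
    · rw [Set.indicator_of_notMem (by exact hP)]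

theorem ofReal_KT {b : ℕ} (hb : 1 < b) (A : Finset ℕ) (m l : ℕ) :
    ENNReal.ofReal (KT b A m l) =
      ((b : ENNReal) ^ l)⁻¹ * ENNReal.ofReal (∑ n ∈ KF b A l, ((n : ℝ) / (b : ℝ) ^ l) ^ m) := by
  unfold KT
  rw [ENNReal.ofReal_mul (by positivity), ENNReal.ofReal_inv_of_pos (by positivity),
    ENNReal.ofReal_pow (by positivity), ENNReal.ofReal_natCast]

theorem lmoment {b : ℕ} (hb : 1 < b) (A : Finset ℕ) (m : ℕ) :
    ∫⁻ x in Set.Ico (0 : ℝ) 1, ENNReal.ofReal (x ^ m) ∂(kempnerMeasure b A)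
      = ∑' l, ENNReal.ofReal (KT b A m l) := by
  rw [← lintegral_indicator measurableSet_Ico]
  unfold kempnerMeasure
  split_ifs with h0
  · simp only [lintegral_sum_measure, lintegral_smul_measure, lintegral_dirac, smul_eq_mul]
    refine tsum_congr fun l => ?_
    rw [ofReal_KT hb, tsum_ind hb m _ (KF b A l) (fun n => mem_KF_of_zero_mem hb h0)]
  · simp only [lintegral_add_measure, lintegral_sum_measure, lintegral_smul_measure,
      lintegral_dirac, smul_eq_mul]
    rw [tsum_eq_zero_add' ENNReal.summable, tsum_eq_zero_add' (f := fun l => ENNReal.ofReal (KT b A m l)) ENNReal.summable,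
      ← add_assoc]
    congr 1
    · rw [tsum_ind hb m _ ∅]
      · simp [KT, KF_zero]
      · intro n
        simp only [Finset.notMem_empty, pow_zero, Nat.lt_one_iff, false_iff]
        rintro ⟨h, rfl⟩
        exact h0 (h.1.2 rfl)
    · refine tsum_congr fun l => ?_
      rw [ofReal_KT hb, tsum_ind hb m _ (KF b A (l + 1)) (fun n => mem_KF_of_zero_notMem hb h0)]

theorem moment_eq {b : ℕ} (hb : 1 < b) (A : Finset ℕ) (m : ℕ) :
    moment b A m = ∑' l, KT b A m l := by
  unfold moment
  rw [integral_eq_lintegral_of_nonneg_ae, lmoment hb, ENNReal.tsum_toReal_eq]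
  · exact tsum_congr fun l => ENNReal.toReal_ofReal (KT_nonneg _ _ _ _)
  · exact fun _ => ENNReal.ofReal_ne_top
  · filter_upwards [ae_restrict_mem measurableSet_Ico] with x hx
    exact pow_nonneg hx.1 m
  · exact (measurable_id.pow_const m).aestronglyMeasurable

theorem moment_rec {b : ℕ} (hb : 1 < b) {A : Finset ℕ} (hA : A ⊂ Finset.range b) (m : ℕ)
    (hm : m ≠ 0) :
    (b : ℝ) ^ (m + 1) * moment b A m =
      ∑ j ∈ Finset.range (m + 1), (m.choose j : ℝ) * (∑ a ∈ A, (a : ℝ) ^ j)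
        * moment b A (m - j) := by
  simp_rw [moment_eq hb]
  rw [(KT_summable hb hA m).tsum_eq_zero_add, KT_zero b A m hm, zero_add, ← tsum_mul_left]
  simp_rw [KT_succ hb hA.1]
  rw [Summable.tsum_finsetSum]
  · simp_rw [tsum_mul_left]
  · exact fun j _ => (KT_summable hb hA (m - j)).mul_left _

theorem kempner_lambda_recurrence (b : ℕ) (hb : 1 < b) (A : Finset ℕ)
    (hA : A ⊂ Finset.range b) (hAne : A.Nonempty) (hA0 : A ≠ {0})
    (m : ℕ) (hm : 2 ≤ m) :
    ((b : ℝ) ^ m - (A.card : ℝ)) * kempnerLambda b A hAne m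
      = ∑ j ∈ Finset.Icc 1 (m - 1),
          (m.choose j : ℝ) * ((∑ a ∈ A, (a : ℝ) ^ j) / ((A.max' hAne : ℕ) : ℝ) ^ j)
            * ((b : ℝ) - 1) ^ j * kempnerLambda b A hAne (m - j) := by
  obtain ⟨k, rfl⟩ : ∃ k, m = k + 1 := ⟨m - 1, by omega⟩
  have hrec := moment_rec hb hA k (by omega)
  rw [Finset.sum_range_succ'] at hrec
  simp only [Nat.choose_zero_right, pow_zero, Finset.sum_const, nsmul_eq_mul, mul_one,
    Nat.cast_one, one_mul, Nat.sub_zero] at hrec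
  have hrec2 : ((b : ℝ) ^ (k + 1) - A.card) * moment b A k =
      ∑ j ∈ Finset.Icc 1 k, (k.choose j : ℝ) * (∑ a ∈ A, (a : ℝ) ^ j) * moment b A (k - j) := by
    rw [sub_mul, hrec, add_sub_cancel_right, Finset.range_eq_Ico,
      Finset.sum_Ico_add' (fun j => (k.choose j : ℝ) * (∑ a ∈ A, (a : ℝ) ^ j) * moment b A (k - j))]
    rfl
  unfold kempnerLambda
  simp only [Nat.add_sub_cancel]
  set f : ℝ := ((A.max' hAne : ℕ) : ℝ)
  have : ((b : ℝ) ^ (k + 1) - A.card) * (((k + 1 : ℕ) : ℝ) * (((b : ℝ) - 1) / f) ^ k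
      * moment b A k / moment b A 0)
      = (((k + 1 : ℕ) : ℝ) * (((b : ℝ) - 1) / f) ^ k / moment b A 0) *
        (((b : ℝ) ^ (k + 1) - A.card) * moment b A k) := by ring
  rw [this, hrec2, Finset.mul_sum]
  refine Finset.sum_congr rfl fun j hj => ?_
  obtain ⟨hj1, hjk⟩ := Finset.mem_Icc.1 hj
  obtain ⟨i, rfl⟩ : ∃ i, k = j + i := ⟨k - j, by omega⟩
  have e1 : j + i + 1 - j = i + 1 := by omega
  have e2 : j + i - j = i := by omega
  rw [e1, e2, Nat.add_sub_cancel]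
  have hc : (((j + i + 1 : ℕ) : ℝ)) * ((j + i).choose j : ℝ)
      = ((j + i + 1).choose j : ℝ) * ((i + 1 : ℕ) : ℝ) := by
    have := Nat.choose_mul_succ_eq (j + i) j
    rw [e1, mul_comm] at this
    exact_mod_cast this
  rw [pow_add]
  calc _ = (((j + i + 1 : ℕ) : ℝ) * ((j + i).choose j : ℝ)) * ((((b : ℝ) - 1) / f) ^ j *
        (((b : ℝ) - 1) / f) ^ i / moment b A 0 * (∑ a ∈ A, (a : ℝ) ^ j) * moment b A i) := by ring
    _ = _ := by rw [hc, div_pow _ _ j]; ring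
end
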